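/- Let γ ∈ SL_d(ℤ), let θ be a real m×n matrix, let t > 0 and 0 < ε < 1, let N be a positive integer, and let α, β be weights of dimensions m and n respectively. If there exists γ̃ ∈ Γ_N such that a_{α,β}(t)·u(θ)·γ·γ̃ ∈ K·A_ε·U, then there exists a primitive vector (p,q) ∈ ℤ^d with p ∈ ℤ^m, q ∈ ℤ^n, (p,q) ≡ γe_1 (mod N), such that ‖θq + p‖_α < ε e^{-t} and ‖q‖_β < ε e^{t}. -/

import Mathlib

open Matrix

/-- The first standard basis vector `e₁ = (1,0,…,0)` of `ℤ^d`. -/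
def stdE1 (d : ℕ) : Fin d → ℤ := fun i => if (i : ℕ) = 0 then 1 else 0

/-- The quasi-norm associated with a weight `α` on `ℝ^k`:
`‖x‖_α = max_j |x j| ^ (1 / α j)`. -/
noncomputable def quasiNorm {k : ℕ} (α : Fin k → ℝ) (x : Fin k → ℝ) : ℝ :=
  ⨆ j, |x j| ^ (1 / α j)

/-- The diagonal flow `a_{α,β}(t) = diag(e^{tα₁},…,e^{tα_m},e^{-tβ₁},…,e^{-tβ_n})`. -/
noncomputable def aDiag (m n : ℕ) (α : Fin m → ℝ) (β : Fin n → ℝ) (t : ℝ) :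
    Matrix (Fin (m + n)) (Fin (m + n)) ℝ :=
  Matrix.diagonal (Fin.append (fun j => Real.exp (t * α j)) (fun j => Real.exp (-(t * β j))))

/-- The unipotent matrix `u(θ)` with blocks `Id_m, θ; 0, Id_n`. -/
def uMat (m n : ℕ) (θ : Fin m → Fin n → ℝ) : Matrix (Fin (m + n)) (Fin (m + n)) ℝ :=
  (Matrix.fromBlocks 1 (Matrix.of θ) 0 1).submatrix finSumFinEquiv.symm finSumFinEquiv.symm

/-- Every column of an integer matrix of determinant one has coordinates with gcd one. -/
theorem gcd_col_eq_one_of_det_eq_one {ι : Type*} [Fintype ι] [DecidableEq ι]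
    (W : Matrix ι ι ℤ) (hW : W.det = 1) (z : ι) : Finset.univ.gcd (fun i => W i z) = 1 := by
  have hdvd : Finset.univ.gcd (fun i => W i z) ∣ 1 := by
    have hadj : (W.adjugate * W) z z = 1 := by simp [Matrix.adjugate_mul, hW]
    rw [← hadj, Matrix.mul_apply]
    exact Finset.dvd_sum fun i hi => (Finset.gcd_dvd hi).mul_left _
  rw [← Finset.normalize_gcd]
  exact normalize_eq_one.2 (isUnit_of_dvd_one hdvd)

theorem mulVec_stdE1 {d : ℕ} (hd : 0 < d) (M : Matrix (Fin d) (Fin d) ℤ) (i : Fin d) :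
    M.mulVec (stdE1 d) i = M i ⟨0, hd⟩ := by
  have hE : stdE1 d = Pi.single ⟨0, hd⟩ 1 := by
    ext j
    simp [stdE1, Pi.single_apply, Fin.ext_iff]
  simp [hE]

theorem mulVec_modEq {ι κ : Type*} [Fintype κ] (N : ℤ) (M : Matrix ι κ ℤ) {v w : κ → ℤ}
    (h : ∀ j, v j ≡ w j [ZMOD N]) (i : ι) : M.mulVec v i ≡ M.mulVec w i [ZMOD N] := by
  rw [Int.modEq_iff_dvd]
  simp only [Matrix.mulVec, dotProduct, ← Finset.sum_sub_distrib, ← mul_sub]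
  exact Finset.dvd_sum fun j _ => ((h j).dvd).mul_left _

/-- The entries of an orthogonal matrix are bounded by one. -/
theorem abs_apply_le_one_of_transpose_mul_self {ι : Type*} [Fintype ι] [DecidableEq ι]
    {k : Matrix ι ι ℝ} (hk : kᵀ * k = 1) (i j : ι) : |k i j| ≤ 1 := by
  have h1 : ∑ l, k l j ^ 2 = 1 := by
    have h := congrFun (congrFun hk j) j
    simpa [Matrix.mul_apply, sq] using h
  rw [← sq_le_one_iff_abs_le_one, ← h1]
  exact Finset.single_le_sum (f := fun l => k l j ^ 2) (fun l _ => sq_nonneg _)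
    (Finset.mem_univ i)

theorem abs_diagonal_mul_unipotent_apply_le {d : ℕ} (hd : 0 < d)
    {k u : Matrix (Fin d) (Fin d) ℝ} {s : Fin d → ℝ} (hk : kᵀ * k = 1)
    (hs : 0 < s ⟨0, hd⟩) (hu1 : ∀ i, u i i = 1) (hu0 : ∀ i j : Fin d, j < i → u i j = 0)
    (i : Fin d) : |(k * Matrix.diagonal s * u) i ⟨0, hd⟩| ≤ s ⟨0, hd⟩ := by
  have hval : (k * Matrix.diagonal s * u) i ⟨0, hd⟩ = k i ⟨0, hd⟩ * s ⟨0, hd⟩ := by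
    rw [Matrix.mul_apply, Finset.sum_eq_single ⟨0, hd⟩]
    · simp [hu1]
    · intro j _ hj
      have : (⟨0, hd⟩ : Fin d) < j := by
        rw [Fin.lt_def]
        exact Nat.pos_of_ne_zero fun h => hj (Fin.ext h)
      rw [hu0 _ _ this, mul_zero]
    · simp
  rw [hval, abs_mul, abs_of_pos hs]
  exact mul_le_of_le_one_left hs.le (abs_apply_le_one_of_transpose_mul_self hk _ _)

theorem uMat_mul_apply_castAdd {m n : ℕ} (θ : Fin m → Fin n → ℝ)
    (M : Matrix (Fin (m + n)) (Fin (m + n)) ℝ) (i : Fin m) (z : Fin (m + n)) :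
    (uMat m n θ * M) (Fin.castAdd n i) z =
      ∑ j, θ i j * M (Fin.natAdd m j) z + M (Fin.castAdd n i) z := by
  simp [uMat, Matrix.mul_apply, Fin.sum_univ_add, Matrix.one_apply, add_comm]

theorem uMat_mul_apply_natAdd {m n : ℕ} (θ : Fin m → Fin n → ℝ)
    (M : Matrix (Fin (m + n)) (Fin (m + n)) ℝ) (j : Fin n) (z : Fin (m + n)) :
    (uMat m n θ * M) (Fin.natAdd m j) z = M (Fin.natAdd m j) z := by
  simp [uMat, Matrix.mul_apply, Fin.sum_univ_add, Matrix.one_apply]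

/-- A vector whose coordinates are contracted below `ε < 1` by `diag(e^{-r α_j})` has
quasi-norm below `ε e^r`. -/
theorem quasiNorm_lt_of_abs_lt {k : ℕ} (hk : 0 < k) {α : Fin k → ℝ} (hα : ∀ j, 0 < α j)
    (hα1 : ∑ j, α j = 1) {ε : ℝ} (hε0 : 0 < ε) (hε1 : ε < 1) {r : ℝ} {x : Fin k → ℝ}
    (hx : ∀ j, |x j| < ε * Real.exp (r * α j)) : quasiNorm α x < ε * Real.exp r := by
  have : Nonempty (Fin k) := ⟨⟨0, hk⟩⟩
  obtain ⟨j, hj⟩ := exists_eq_ciSup_of_finite (f := fun j => |x j| ^ (1 / α j))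
  rw [quasiNorm, ← hj]
  have hle : α j ≤ 1 := hα1 ▸
    Finset.single_le_sum (fun i _ => (hα i).le) (Finset.mem_univ j)
  calc |x j| ^ (1 / α j) < (ε * Real.exp (r * α j)) ^ (1 / α j) :=
        Real.rpow_lt_rpow (abs_nonneg _) (hx j) (one_div_pos.2 (hα j))
    _ = ε ^ (1 / α j) * Real.exp r := by
        rw [Real.mul_rpow hε0.le (Real.exp_pos _).le, ← Real.exp_mul, mul_assoc,
          mul_one_div_cancel (hα j).ne', mul_one]
    _ ≤ ε * Real.exp r := by
        gcongr
        exact (Real.rpow_le_rpow_of_exponent_ge hε0 hε1.le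
          (one_le_one_div (hα j) hle)).trans_eq (Real.rpow_one ε)

/-- Corollary 2.3 of the paper: if `a_{α,β}(t) u(θ) γ Γ_N` meets `K ⬝ A_ε ⬝ U`, then
there is a primitive `(p,q) ∈ ℤ^m × ℤ^n` congruent to `γ e₁ (mod N)` with
`‖θ q + p‖_α < ε e^{-t}` and `‖q‖_β < ε e^{t}`. -/
theorem exists_congruent_solution_of_mem_KAU (m n : ℕ) (hm : 0 < m) (hn : 0 < n)
    (N : ℕ) (hN : 0 < N) (t : ℝ) (ht : 0 < t) (ε : ℝ) (hε0 : 0 < ε) (hε1 : ε < 1)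
    (α : Fin m → ℝ) (hαpos : ∀ j, 0 < α j) (hα1 : ∑ j, α j = 1)
    (β : Fin n → ℝ) (hβpos : ∀ j, 0 < β j) (hβ1 : ∑ j, β j = 1)
    (θ : Fin m → Fin n → ℝ)
    (γ : Matrix (Fin (m + n)) (Fin (m + n)) ℤ) (hγ : γ.det = 1)
    (h : ∃ γt : Matrix (Fin (m + n)) (Fin (m + n)) ℤ, γt.det = 1 ∧
      (∀ i, γt.mulVec (stdE1 (m + n)) i ≡ stdE1 (m + n) i [ZMOD N]) ∧
      ∃ k a u : Matrix (Fin (m + n)) (Fin (m + n)) ℝ,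
        (kᵀ * k = 1 ∧ k.det = 1) ∧
        (∃ s : Fin (m + n) → ℝ, a = Matrix.diagonal s ∧ (∀ i, 0 < s i) ∧
          a.det = 1 ∧ ∀ i : Fin (m + n), (i : ℕ) = 0 → s i < ε) ∧
        ((∀ i, u i i = 1) ∧ ∀ i j : Fin (m + n), j < i → u i j = 0) ∧
        aDiag m n α β t * uMat m n θ * γ.map (Int.cast : ℤ → ℝ) *
          γt.map (Int.cast : ℤ → ℝ) = k * a * u) :
    ∃ p : Fin m → ℤ, ∃ q : Fin n → ℤ,
      Fin.append p q ≠ 0 ∧ Finset.univ.gcd (Fin.append p q) = 1 ∧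
      (∀ i, Fin.append p q i ≡ γ.mulVec (stdE1 (m + n)) i [ZMOD N]) ∧
      quasiNorm α (fun i => ∑ j, θ i j * (q j : ℝ) + (p i : ℝ)) < ε * Real.exp (-t) ∧
      quasiNorm β (fun j => (q j : ℝ)) < ε * Real.exp t := by
  obtain ⟨γt, hγt, hcong, k, a, u, ⟨hk, -⟩, ⟨s, rfl, hs, -, hsε⟩, ⟨hu1, hu0⟩, heq⟩ := h
  have hd : 0 < m + n := by omega
  set z : Fin (m + n) := ⟨0, hd⟩ with hz
  set W := γ * γt with hW
  have happ : Fin.append (fun i => W (Fin.castAdd n i) z) (fun j => W (Fin.natAdd m j) z) =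
      fun i => W i z := Fin.append_castAdd_natAdd (f := fun i => W i z)
  have hgcd := gcd_col_eq_one_of_det_eq_one W (by rw [hW, Matrix.det_mul, hγ, hγt, one_mul]) z
  have hmap : γ.map (Int.cast : ℤ → ℝ) * γt.map (Int.cast : ℤ → ℝ) = W.map Int.cast :=
    (Matrix.map_mul (f := Int.castRingHom ℝ)).symm
  rw [Matrix.mul_assoc, hmap, Matrix.mul_assoc] at heq
  have hbound (i : Fin (m + n)) :
      |(aDiag m n α β t * (uMat m n θ * W.map (Int.cast : ℤ → ℝ))) i z| < ε := by
    rw [heq]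
    exact (abs_diagonal_mul_unipotent_apply_le hd hk (hs _) hu1 hu0 i).trans_lt (hsε _ rfl)
  refine ⟨fun i => W (Fin.castAdd n i) z, fun j => W (Fin.natAdd m j) z, ?_, ?_, ?_, ?_, ?_⟩
  · intro h0
    rw [happ] at h0
    rw [h0] at hgcd
    have : Finset.univ.gcd (0 : Fin (m + n) → ℤ) = 0 := Finset.gcd_eq_zero_iff.2 (by simp)
    omega
  · rw [happ, hgcd]
  · intro i
    rw [happ]
    have := mulVec_modEq N γ hcong i
    rwa [Matrix.mulVec_mulVec, mulVec_stdE1 hd] at this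
  · refine quasiNorm_lt_of_abs_lt hm hαpos hα1 hε0 hε1 fun i => ?_
    have := hbound (Fin.castAdd n i)
    rw [aDiag, Matrix.diagonal_mul, uMat_mul_apply_castAdd, Fin.append_left, abs_mul,
      Real.abs_exp] at this
    rw [neg_mul, Real.exp_neg, ← div_eq_mul_inv, lt_div_iff₀' (Real.exp_pos _)]
    exact this
  · refine quasiNorm_lt_of_abs_lt hn hβpos hβ1 hε0 hε1 fun j => ?_
    have := hbound (Fin.natAdd m j)
    rw [aDiag, Matrix.diagonal_mul, uMat_mul_apply_natAdd, Fin.append_right, abs_mul,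
      Real.abs_exp, Real.exp_neg, inv_mul_lt_iff₀' (Real.exp_pos _)] at this
    exact this
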